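/- arXiv:2012.03126 — 9 statements merged into one kernel-verified Lean document; each statement's English description precedes it below -/
import Mathlib

section
/- (Theorem 1, quadratic instance; strong duality for DROT.) The supremum of J(f, g) = ⟨f, a⟩ + ⟨g, b⟩ − (‖f‖² + ‖g‖²)/γ over all (f, g) in the DROT feasible set F equals the infimum of D(P) = ⟨C, P⟩ + (γ/4)(‖a − P1‖² + ‖b − Pᵀ1‖²) over all matrices P ∈ ℝ^{m×n} with P_{ij} ≥ 0 for all i, j; moreover both the supremum and the infimum are attained. -/
/-- The quadratic DROT objective. -/
noncomputable def drotPrimal {m n : ℕ} (a : Fin m → ℝ) (b : Fin n → ℝ) (γ : ℝ)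
    (f : Fin m → ℝ) (g : Fin n → ℝ) : ℝ :=
  (∑ i, f i * a i) + (∑ j, g j * b j) - ((∑ i, (f i) ^ 2) + (∑ j, (g j) ^ 2)) / γ

/-- The quadratic dual DROT objective. -/
noncomputable def drotDual {m n : ℕ} (a : Fin m → ℝ) (b : Fin n → ℝ)
    (C : Fin m → Fin n → ℝ) (γ : ℝ) (P : Fin m → Fin n → ℝ) : ℝ :=
  (∑ i, ∑ j, C i j * P i j)
    + (γ / 4) * ((∑ i, (a i - ∑ j, P i j) ^ 2) + (∑ j, (b j - ∑ i, P i j) ^ 2))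

section

variable {m n : ℕ} (a : Fin m → ℝ) (b : Fin n → ℝ) (C : Fin m → Fin n → ℝ) {γ : ℝ}

lemma sum_mul_sub_sub_eq (P : Fin m → Fin n → ℝ) (f : Fin m → ℝ) (g : Fin n → ℝ) :
    ∑ i, ∑ j, P i j * (C i j - f i - g j) =
      (∑ i, ∑ j, C i j * P i j) - (∑ i, f i * ∑ j, P i j) - ∑ j, g j * ∑ i, P i j := by
  simp_rw [Finset.mul_sum]
  rw [Finset.sum_comm (f := fun j i => g j * P i j)]
  simp_rw [← Finset.sum_sub_distrib]
  exact Finset.sum_congr rfl fun i _ => Finset.sum_congr rfl fun j _ => by ring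

/-- The duality gap as slackness plus a sum of squares. -/
lemma drotDual_sub_drotPrimal (hγ : 0 < γ) (P : Fin m → Fin n → ℝ)
    (f : Fin m → ℝ) (g : Fin n → ℝ) :
    drotDual a b C γ P - drotPrimal a b γ f g =
      (∑ i, ∑ j, P i j * (C i j - f i - g j))
        + ((∑ i, (γ / 2 * (a i - ∑ j, P i j) - f i) ^ 2)
          + ∑ j, (γ / 2 * (b j - ∑ i, P i j) - g j) ^ 2) / γ := by
  have key : ∀ {k : ℕ} (u r v : Fin k → ℝ), (∑ i, (γ / 2 * (u i - r i) - v i) ^ 2) / γ =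
      γ / 4 * (∑ i, (u i - r i) ^ 2) - (∑ i, v i * u i) + (∑ i, v i * r i)
        + (∑ i, v i ^ 2) / γ := by
    intro k u r v
    simp_rw [Finset.sum_div, Finset.mul_sum, ← Finset.sum_sub_distrib, ← Finset.sum_add_distrib]
    refine Finset.sum_congr rfl fun i _ => ?_
    field_simp
    ring
  rw [sum_mul_sub_sub_eq, add_div, key a (fun i => ∑ j, P i j) f,
    key b (fun j => ∑ i, P i j) g, drotDual, drotPrimal]
  ring

lemma sum_mul_slack_le_drotDual_sub_drotPrimal (hγ : 0 < γ) (P : Fin m → Fin n → ℝ)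
    (f : Fin m → ℝ) (g : Fin n → ℝ) :
    ∑ i, ∑ j, P i j * (C i j - f i - g j) ≤ drotDual a b C γ P - drotPrimal a b γ f g := by
  rw [drotDual_sub_drotPrimal a b C hγ]
  exact le_add_of_nonneg_right (by positivity)

/-- Weak duality. -/
lemma drotPrimal_le_drotDual (hγ : 0 < γ) {P : Fin m → Fin n → ℝ} (hP : ∀ i j, 0 ≤ P i j)
    {f : Fin m → ℝ} {g : Fin n → ℝ} (hfg : ∀ i j, f i + g j ≤ C i j) :
    drotPrimal a b γ f g ≤ drotDual a b C γ P := by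
  have h := sum_mul_slack_le_drotDual_sub_drotPrimal a b C hγ P f g
  have h0 : 0 ≤ ∑ i, ∑ j, P i j * (C i j - f i - g j) :=
    Finset.sum_nonneg fun i _ => Finset.sum_nonneg fun j _ =>
      mul_nonneg (hP i j) (by linarith [hfg i j])
  linarith

lemma continuous_drotDual : Continuous (drotDual a b C γ) := by
  unfold drotDual
  fun_prop

lemma exists_drotDual_minimizer (hγ : 0 < γ) :
    ∃ P : Fin m → Fin n → ℝ, (∀ i j, 0 ≤ P i j) ∧
      ∀ Q : Fin m → Fin n → ℝ, (∀ i j, 0 ≤ Q i j) → drotDual a b C γ P ≤ drotDual a b C γ Q := by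
  set c : ℝ := ∑ i, ∑ j, |C i j|
  have hc : ∀ i j, -c ≤ C i j := fun i j => by
    have h1 : |C i j| ≤ ∑ j, |C i j| :=
      Finset.single_le_sum (f := fun j => |C i j|) (fun _ _ => abs_nonneg _) (Finset.mem_univ j)
    have h2 : ∑ j, |C i j| ≤ c :=
      Finset.single_le_sum (f := fun i => ∑ j, |C i j|)
        (fun _ _ => Finset.sum_nonneg fun _ _ => abs_nonneg _) (Finset.mem_univ i)
    linarith [neg_abs_le (C i j)]
  set J₀ := drotPrimal a b γ (fun _ => -c - 1) (fun _ : Fin n => 0)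
  have hentry : ∀ Q : Fin m → Fin n → ℝ, (∀ i j, 0 ≤ Q i j) →
      ∀ i j, Q i j ≤ drotDual a b C γ Q - J₀ := fun Q hQ i j => by
    refine le_trans ?_ (sum_mul_slack_le_drotDual_sub_drotPrimal a b C hγ Q _ _)
    have hle : ∀ i j, Q i j ≤ Q i j * (C i j - (-c - 1) - 0) := fun i j =>
      le_mul_of_one_le_right (hQ i j) (by linarith [hc i j])
    have h0 : ∀ i j, 0 ≤ Q i j * (C i j - (-c - 1) - 0) := fun i j => (hQ i j).trans (hle i j)
    refine (hle i j).trans ?_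
    refine (Finset.single_le_sum (f := fun j => Q i j * (C i j - (-c - 1) - 0))
      (fun j _ => h0 i j) (Finset.mem_univ j)).trans ?_
    exact Finset.single_le_sum (f := fun i => ∑ j, Q i j * (C i j - (-c - 1) - 0))
      (fun i _ => Finset.sum_nonneg fun j _ => h0 i j) (Finset.mem_univ i)
  set R := max 0 (drotDual a b C γ 0 - J₀)
  have hzero : (0 : Fin m → Fin n → ℝ) ∈ Set.Icc (0 : Fin m → Fin n → ℝ) fun _ _ => R :=
    ⟨le_rfl, fun _ _ => le_max_left _ _⟩
  obtain ⟨P, hP, hmin⟩ := (isCompact_Icc (a := (0 : Fin m → Fin n → ℝ))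
    (b := fun _ _ => R)).exists_isMinOn ⟨0, hzero⟩ (continuous_drotDual a b C).continuousOn
  refine ⟨P, fun i j => hP.1 i j, fun Q hQ => ?_⟩
  rcases le_total (drotDual a b C γ Q) (drotDual a b C γ 0) with h | h
  · exact hmin ⟨fun i j => hQ i j, fun i j =>
      (hentry Q hQ i j).trans ((sub_le_sub_right h _).trans (le_max_right _ _))⟩
  · exact (hmin hzero).trans h

lemma drotDual_add_smul (P Q : Fin m → Fin n → ℝ) (t : ℝ) :
    drotDual a b C γ (P + t • Q) = drotDual a b C γ P
      + t * (∑ i, ∑ j, Q i j * (C i j - γ / 2 * (a i - ∑ j, P i j) - γ / 2 * (b j - ∑ i, P i j)))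
      + t ^ 2 * (γ / 4 * ((∑ i, (∑ j, Q i j) ^ 2) + ∑ j, (∑ i, Q i j) ^ 2)) := by
  have key : ∀ {k : ℕ} (u r q : Fin k → ℝ), γ / 4 * ∑ i, (u i - (r i + t * q i)) ^ 2 =
      γ / 4 * (∑ i, (u i - r i) ^ 2) - t * (∑ i, γ / 2 * (u i - r i) * q i)
        + t ^ 2 * (γ / 4 * ∑ i, q i ^ 2) := by
    intro k u r q
    simp_rw [Finset.mul_sum, ← Finset.sum_sub_distrib, ← Finset.sum_add_distrib]
    exact Finset.sum_congr rfl fun i _ => by ring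
  have hcost : ∑ i, ∑ j, C i j * (P i j + t * Q i j) =
      (∑ i, ∑ j, C i j * P i j) + t * ∑ i, ∑ j, C i j * Q i j := by
    simp_rw [Finset.mul_sum, ← Finset.sum_add_distrib]
    exact Finset.sum_congr rfl fun i _ => Finset.sum_congr rfl fun j _ => by ring
  rw [sum_mul_sub_sub_eq C Q (fun i => γ / 2 * (a i - ∑ j, P i j))
    (fun j => γ / 2 * (b j - ∑ i, P i j))]
  simp only [drotDual, Pi.add_apply, Pi.smul_apply, smul_eq_mul]
  rw [hcost]
  simp_rw [Finset.sum_add_distrib, ← Finset.mul_sum]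
  rw [mul_add, key a (fun i => ∑ j, P i j) (fun i => ∑ j, Q i j),
    key b (fun j => ∑ i, P i j) (fun j => ∑ i, Q i j)]
  ring

end

lemma nonneg_of_forall_mul_add_sq_mul_nonneg {A B : ℝ}
    (h : ∀ t : ℝ, 0 < t → t ≤ 1 → 0 ≤ t * A + t ^ 2 * B) : 0 ≤ A := by
  by_contra! hA
  have hD : 0 < |B| + -A := by linarith [abs_nonneg B]
  have ht : 0 < -A / (2 * (|B| + -A)) := by apply div_pos <;> linarith
  have htm : -A / (2 * (|B| + -A)) * (2 * (|B| + -A)) = -A := by field_simp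
  set t := -A / (2 * (|B| + -A))
  have ht1 : t ≤ 1 := by nlinarith [abs_nonneg B]
  have h1 := h t ht ht1
  have h2 : 0 ≤ A + t * B := by
    by_contra! hlt
    nlinarith
  nlinarith [le_abs_self B, mul_le_mul_of_nonneg_left (le_abs_self B) ht.le]

/-- Theorem 1 (quadratic instance): strong duality for DROT. The supremum of the
quadratic DROT objective over the feasible set equals the infimum of the quadratic
dual objective over nonnegative matrices, and both are attained. -/
theorem drot_quadratic_strong_duality (m n : ℕ) (hm : 0 < m) (hn : 0 < n)
    (a : Fin m → ℝ) (b : Fin n → ℝ) (C : Matrix (Fin m) (Fin n) ℝ)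
    (γ : ℝ) (hγ : 0 < γ) :
    ∃ S : ℝ,
      IsGreatest {x : ℝ | ∃ f : Fin m → ℝ, ∃ g : Fin n → ℝ,
        (∀ i j, f i + g j ≤ C i j) ∧
        ((∑ i, f i * a i) + (∑ j, g j * b j)
          - ((∑ i, (f i) ^ 2) + (∑ j, (g j) ^ 2)) / γ = x)} S ∧
      IsLeast {x : ℝ | ∃ P : Matrix (Fin m) (Fin n) ℝ,
        (∀ i j, 0 ≤ P i j) ∧
        ((∑ i, ∑ j, C i j * P i j)
          + (γ / 4) * ((∑ i, (a i - ∑ j, P i j) ^ 2)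
            + (∑ j, (b j - ∑ i, P i j) ^ 2)) = x)} S := by
  obtain ⟨P, hP, hmin⟩ := exists_drotDual_minimizer a b C hγ
  set f : Fin m → ℝ := fun i => γ / 2 * (a i - ∑ j, P i j)
  set g : Fin n → ℝ := fun j => γ / 2 * (b j - ∑ i, P i j)
  have hvar : ∀ Q : Fin m → Fin n → ℝ, (∀ i j, 0 ≤ P i j + Q i j) →
      0 ≤ ∑ i, ∑ j, Q i j * (C i j - f i - g j) := fun Q hQ => by
    refine nonneg_of_forall_mul_add_sq_mul_nonneg
      (B := γ / 4 * ((∑ i, (∑ j, Q i j) ^ 2) + ∑ j, (∑ i, Q i j) ^ 2)) fun t ht ht1 => ?_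
    have h := hmin (P + t • Q) fun i j => by
      simp only [Pi.add_apply, Pi.smul_apply, smul_eq_mul]
      nlinarith [hP i j, hQ i j, mul_nonneg ht.le (hQ i j),
        mul_nonneg (sub_nonneg.2 ht1) (hP i j)]
    have h' := h.trans_eq (drotDual_add_smul a b C P Q t)
    linarith
  have hfeas : ∀ i j, f i + g j ≤ C i j := fun i j => by
    have h := hvar (fun i' j' => if i' = i then (if j' = j then 1 else 0) else 0) fun i' j' =>
      add_nonneg (hP i' j') (by split_ifs <;> norm_num)
    simp only [ite_mul, one_mul, zero_mul] at h
    rw [Finset.sum_eq_single i (fun i' _ hi => by simp [hi]) (by simp)] at h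
    simp only [if_true, Finset.sum_ite_eq', Finset.mem_univ] at h
    linarith
  have hslack : ∑ i, ∑ j, P i j * (C i j - f i - g j) ≤ 0 := by
    have h := hvar (-P) fun i j => by simp
    simpa only [Pi.neg_apply, neg_mul, Finset.sum_neg_distrib, Left.nonneg_neg_iff] using h
  have heq : drotPrimal a b γ f g = drotDual a b C γ P := by
    refine le_antisymm (drotPrimal_le_drotDual a b C hγ hP hfeas) ?_
    have h := drotDual_sub_drotPrimal a b C hγ P f g
    have hsq : (∑ i, (γ / 2 * (a i - ∑ j, P i j) - f i) ^ 2)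
        + ∑ j, (γ / 2 * (b j - ∑ i, P i j) - g j) ^ 2 = 0 := by simp [f, g]
    rw [hsq, zero_div, add_zero] at h
    linarith
  refine ⟨drotDual a b C γ P, ⟨⟨f, g, hfeas, heq⟩, ?_⟩, ⟨⟨P, hP, rfl⟩, ?_⟩⟩
  · rintro x ⟨f', g', hfg, rfl⟩
    exact drotPrimal_le_drotDual a b C hγ hP hfg
  · rintro x ⟨Q, hQ, rfl⟩
    exact hmin Q hQ
end

section
/- (Weak duality for quadratic DROT.) For every (f, g) in the DROT feasible set F and every matrix P ∈ ℝ^{m×n} with P_{ij} ≥ 0 for all i, j, one has J(f, g) = ⟨f, a⟩ + ⟨g, b⟩ − (‖f‖² + ‖g‖²)/γ ≤ ⟨C, P⟩ + (γ/4)(‖a − P1‖² + ‖b − Pᵀ1‖²) = D(P). -/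
/-- Young's inequality, summed over coordinates: the quadratically regularized pairing with `a`
is bounded by the pairing with `r` plus a quadratic penalty on `a - r`. -/
theorem sum_mul_sub_sum_sq_div_le {ι : Type*} [Fintype ι] (x a r : ι → ℝ) {γ : ℝ} (hγ : 0 < γ) :
    (∑ i, x i * a i) - (∑ i, (x i) ^ 2) / γ
      ≤ (∑ i, x i * r i) + (γ / 4) * ∑ i, (a i - r i) ^ 2 := by
  rw [Finset.sum_div, Finset.mul_sum, ← Finset.sum_sub_distrib, ← Finset.sum_add_distrib]
  refine Finset.sum_le_sum fun i _ => ?_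
  have h : x i * r i + γ / 4 * (a i - r i) ^ 2 - (x i * a i - (x i) ^ 2 / γ)
      = (x i - γ / 2 * (a i - r i)) ^ 2 / γ := by
    field_simp
    ring
  have : 0 ≤ (x i - γ / 2 * (a i - r i)) ^ 2 / γ := by positivity
  linarith

/-- Weak duality for quadratic DROT: every feasible primal value is at most every
dual value. -/
theorem drot_quadratic_weak_duality (m n : ℕ) (hm : 0 < m) (hn : 0 < n)
    (a : Fin m → ℝ) (b : Fin n → ℝ) (C : Matrix (Fin m) (Fin n) ℝ)
    (γ : ℝ) (hγ : 0 < γ)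
    (f : Fin m → ℝ) (g : Fin n → ℝ)
    (hfg : ∀ i j, f i + g j ≤ C i j)
    (P : Matrix (Fin m) (Fin n) ℝ) (hP : ∀ i j, 0 ≤ P i j) :
    (∑ i, f i * a i) + (∑ j, g j * b j)
        - ((∑ i, (f i) ^ 2) + (∑ j, (g j) ^ 2)) / γ
      ≤ (∑ i, ∑ j, C i j * P i j)
        + (γ / 4) * ((∑ i, (a i - ∑ j, P i j) ^ 2)
          + (∑ j, (b j - ∑ i, P i j) ^ 2)) := by
  have hf := sum_mul_sub_sum_sq_div_le f a (fun i => ∑ j, P i j) hγ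
  have hg := sum_mul_sub_sum_sq_div_le g b (fun j => ∑ i, P i j) hγ
  have hC : (∑ i, f i * ∑ j, P i j) + (∑ j, g j * ∑ i, P i j) ≤ ∑ i, ∑ j, C i j * P i j := by
    simp only [Finset.mul_sum]
    rw [Finset.sum_comm (f := fun j i => g j * P i j), ← Finset.sum_add_distrib]
    refine Finset.sum_le_sum fun i _ => ?_
    rw [← Finset.sum_add_distrib]
    refine Finset.sum_le_sum fun j _ => ?_
    rw [← add_mul]
    exact mul_le_mul_of_nonneg_right (hfg i j) (hP i j)
  rw [add_div, mul_add]
  linarith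
end

section
/- (Theorem 1, exponential instance; strong duality with mass-destruction constraint.) Assume every entry of a and of b is strictly positive. Then the supremum over (f, g) in the DROT feasible set F of ⟨f, a⟩ + ⟨g, b⟩ − (Σ_i e^{f_i} + Σ_j e^{g_j})/γ equals the infimum, over matrices P ∈ ℝ^{m×n} satisfying P_{ij} ≥ 0 for all i, j, (P1)_i ≤ a_i for all i, and (Pᵀ1)_j ≤ b_j for all j, of ⟨C, P⟩ + Σ_i (a_i − (P1)_i)(log(γ(a_i − (P1)_i)) − 1) + Σ_j (b_j − (Pᵀ1)_j)(log(γ(b_j − (Pᵀ1)_j)) − 1), where a summand with a_i − (P1)_i = 0 (resp. b_j − (Pᵀ1)_j = 0) is interpreted as 0; moreover the infimum is attained. -/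
open Real

/-- The scaled convex conjugate of the exponential: the conjugate of `u ↦ exp u / γ`,
restricted to nonnegative arguments. -/
noncomputable def expConj (γ x : ℝ) : ℝ := x * (Real.log (γ * x) - 1)

lemma continuous_expConj {γ : ℝ} (hγ : 0 < γ) : Continuous (expConj γ) := by
  have h : expConj γ = fun x => γ⁻¹ * ((γ * x) * Real.log (γ * x)) - x := by
    funext x
    unfold expConj
    field_simp
  rw [h]
  have := Real.continuous_mul_log.comp (continuous_const_mul γ)
  exact (continuous_const.mul this).sub continuous_id

/-- The Fenchel–Young inequality for the scaled exponential. -/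
lemma mul_sub_exp_div_le_expConj {γ x : ℝ} (hγ : 0 < γ) (hx : 0 ≤ x) (u : ℝ) :
    u * x - Real.exp u / γ ≤ expConj γ x := by
  unfold expConj
  rcases hx.eq_or_lt with rfl | hx
  · have : 0 < Real.exp u / γ := by positivity
    linarith
  · have h := Real.add_one_le_exp (u - Real.log (γ * x))
    rw [Real.exp_sub, Real.exp_log (by positivity)] at h
    have h2 := mul_le_mul_of_nonneg_left h hx.le
    have h3 : x * (Real.exp u / (γ * x)) = Real.exp u / γ := by field_simp
    rw [h3] at h2
    linarith

/-- The equality case of the Fenchel–Young inequality for the scaled exponential. -/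
lemma log_mul_sub_exp_div_eq_expConj {γ x : ℝ} (hγ : 0 < γ) (hx : 0 < x) :
    Real.log (γ * x) * x - Real.exp (Real.log (γ * x)) / γ = expConj γ x := by
  unfold expConj
  rw [Real.exp_log (by positivity)]
  field_simp

lemma expConj_sub_le {γ r t : ℝ} (hγ : 0 < γ) (hr : 0 ≤ r) (hrt : 0 < r - t) :
    expConj γ (r - t) - expConj γ r ≤ -t * Real.log (γ * (r - t)) := by
  have h1 := mul_sub_exp_div_le_expConj hγ hr (Real.log (γ * (r - t)))
  have h2 := log_mul_sub_exp_div_eq_expConj hγ hrt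
  linarith

lemma mul_le_exp_of_forall_expConj_le {γ r s c : ℝ} (hγ : 0 < γ) (hr : 0 < r) (hs : 0 < s)
    (h : ∀ t, 0 ≤ t → t ≤ r → t ≤ s →
      expConj γ r + expConj γ s ≤ c * t + expConj γ (r - t) + expConj γ (s - t)) :
    (γ * r) * (γ * s) ≤ Real.exp c := by
  have hlim : Filter.Tendsto (fun t : ℝ => (γ * (r - t)) * (γ * (s - t)))
      (nhdsWithin 0 (Set.Ioi 0)) (nhds ((γ * (r - 0)) * (γ * (s - 0)))) :=
    ((by fun_prop : Continuous fun t : ℝ => (γ * (r - t)) * (γ * (s - t))).tendsto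
      0).mono_left nhdsWithin_le_nhds
  rw [sub_zero, sub_zero] at hlim
  refine le_of_tendsto hlim ?_
  filter_upwards [Ioo_mem_nhdsGT (lt_min hr hs)] with t ht
  have htr : 0 < r - t := sub_pos.2 (ht.2.trans_le (min_le_left _ _))
  have hts : 0 < s - t := sub_pos.2 (ht.2.trans_le (min_le_right _ _))
  have h1 := h t ht.1.le (by linarith) (by linarith)
  have h2 := expConj_sub_le hγ hr.le htr
  have h3 := expConj_sub_le hγ hs.le hts
  rw [← Real.log_le_iff_le_exp (by positivity), Real.log_mul (by positivity) (by positivity)]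
  refine le_of_mul_le_mul_left ?_ ht.1
  linarith

lemma exp_le_mul_of_forall_expConj_le {γ r s c p : ℝ} (hγ : 0 < γ) (hr : 0 ≤ r) (hs : 0 ≤ s)
    (hp : 0 < p)
    (h : ∀ t, 0 ≤ t → t ≤ p →
      expConj γ r + expConj γ s ≤ c * (-t) + expConj γ (r - -t) + expConj γ (s - -t)) :
    Real.exp c ≤ (γ * r) * (γ * s) := by
  have hlim : Filter.Tendsto (fun t : ℝ => (γ * (r - -t)) * (γ * (s - -t)))
      (nhdsWithin 0 (Set.Ioi 0)) (nhds ((γ * (r - -0)) * (γ * (s - -0)))) :=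
    ((by fun_prop : Continuous fun t : ℝ => (γ * (r - -t)) * (γ * (s - -t))).tendsto
      0).mono_left nhdsWithin_le_nhds
  rw [neg_zero, sub_zero, sub_zero] at hlim
  refine ge_of_tendsto hlim ?_
  filter_upwards [Ioo_mem_nhdsGT hp] with t ht
  have ht0 := ht.1
  have htr : 0 < r - -t := by linarith
  have hts : 0 < s - -t := by linarith
  have h1 := h t ht.1.le ht.2.le
  have h2 := expConj_sub_le hγ hr htr
  have h3 := expConj_sub_le hγ hs hts
  rw [← Real.le_log_iff_exp_le (by positivity), Real.log_mul (by positivity) (by positivity)]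
  refine le_of_mul_le_mul_left ?_ ht.1
  linarith

section Transport

variable {ι κ : Type*}

/-- The plan `P` with its `(i, j)` entry increased by `t`. -/
def increaseEntry [DecidableEq ι] [DecidableEq κ] (P : ι → κ → ℝ) (i : ι) (j : κ) (t : ℝ) :
    ι → κ → ℝ :=
  fun k l => P k l + if k = i ∧ l = j then t else 0

lemma sum_row_increaseEntry [DecidableEq ι] [DecidableEq κ] [Fintype κ] (P : ι → κ → ℝ)
    (i : ι) (j : κ) (t : ℝ) (k : ι) :
    ∑ l, increaseEntry P i j t k l = (∑ l, P k l) + if k = i then t else 0 := by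
  simp [increaseEntry, Finset.sum_add_distrib, ite_and]

lemma sum_col_increaseEntry [DecidableEq ι] [DecidableEq κ] [Fintype ι] (P : ι → κ → ℝ)
    (i : ι) (j : κ) (t : ℝ) (l : κ) :
    ∑ k, increaseEntry P i j t k l = (∑ k, P k l) + if l = j then t else 0 := by
  simp [increaseEntry, Finset.sum_add_distrib, ite_and]

lemma sum_comp_sub_ite [DecidableEq ι] [Fintype ι] (F : ℝ → ℝ) (x : ι → ℝ) (i : ι) (t : ℝ) :
    ∑ k, F (x k - if k = i then t else 0) = (∑ k, F (x k)) + (F (x i - t) - F (x i)) := by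
  rw [← sub_eq_iff_eq_add', ← Finset.sum_sub_distrib, Finset.sum_eq_single i]
  · simp
  · intro k _ hk
    simp [hk]
  · simp

variable [Fintype ι] [Fintype κ]

/-- Transport plans whose marginals are dominated by `a` and `b`. -/
def subcouplings (a : ι → ℝ) (b : κ → ℝ) : Set (ι → κ → ℝ) :=
  {P | (∀ i j, 0 ≤ P i j) ∧ (∀ i, ∑ j, P i j ≤ a i) ∧ ∀ j, ∑ i, P i j ≤ b j}

/-- Transport cost plus the conjugate penalty on the destroyed mass. -/
noncomputable def destructionCost (a : ι → ℝ) (b : κ → ℝ) (C : ι → κ → ℝ) (γ : ℝ)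
    (P : ι → κ → ℝ) : ℝ :=
  (∑ i, ∑ j, C i j * P i j) + (∑ i, expConj γ (a i - ∑ j, P i j))
    + ∑ j, expConj γ (b j - ∑ i, P i j)

lemma isCompact_subcouplings (a : ι → ℝ) (b : κ → ℝ) : IsCompact (subcouplings a b) := by
  refine (isCompact_Icc (a := (0 : ι → κ → ℝ)) (b := fun i _ => a i)).of_isClosed_subset ?_ ?_
  · simp only [subcouplings, Set.ofPred_and, Set.ofPred_forall]
    refine .inter ?_ (.inter ?_ ?_)
    · exact isClosed_iInter fun i => isClosed_iInter fun j =>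
        isClosed_le (by fun_prop) (by fun_prop)
    · exact isClosed_iInter fun i => isClosed_le (by fun_prop) (by fun_prop)
    · exact isClosed_iInter fun j => isClosed_le (by fun_prop) (by fun_prop)
  · rintro P ⟨h0, ha, -⟩
    exact ⟨fun i j => h0 i j, fun i j =>
      (Finset.single_le_sum (fun k _ => h0 i k) (Finset.mem_univ j)).trans (ha i)⟩

lemma continuous_destructionCost (a : ι → ℝ) (b : κ → ℝ) (C : ι → κ → ℝ) {γ : ℝ} (hγ : 0 < γ) :
    Continuous (destructionCost a b C γ) := by
  have := continuous_expConj hγ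
  unfold destructionCost
  fun_prop

lemma dual_value_eq (a f : ι → ℝ) (b g : κ → ℝ) (γ : ℝ) (P : ι → κ → ℝ) :
    (∑ i, f i * a i) + (∑ j, g j * b j) - ((∑ i, Real.exp (f i)) + ∑ j, Real.exp (g j)) / γ
      = (∑ i, ∑ j, (f i + g j) * P i j)
        + (∑ i, (f i * (a i - ∑ j, P i j) - Real.exp (f i) / γ))
        + ∑ j, (g j * (b j - ∑ i, P i j) - Real.exp (g j) / γ) := by
  have h : ∑ i, ∑ j, g j * P i j = ∑ j, g j * ∑ i, P i j := by
    rw [Finset.sum_comm]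
    simp only [Finset.mul_sum]
  simp only [add_mul, mul_sub, Finset.sum_add_distrib, Finset.sum_sub_distrib, add_div,
    Finset.sum_div, h]
  simp only [Finset.mul_sum]
  ring

lemma dual_value_le_destructionCost {a f : ι → ℝ} {b g : κ → ℝ} {C P : ι → κ → ℝ} {γ : ℝ}
    (hγ : 0 < γ) (hP : P ∈ subcouplings a b) (hfg : ∀ i j, f i + g j ≤ C i j) :
    (∑ i, f i * a i) + (∑ j, g j * b j) - ((∑ i, Real.exp (f i)) + ∑ j, Real.exp (g j)) / γ
      ≤ destructionCost a b C γ P := by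
  rw [dual_value_eq a f b g γ P, destructionCost]
  obtain ⟨h0, ha, hb⟩ := hP
  gcongr with i _ j _ i _ j _
  · exact h0 i j
  · exact hfg i j
  · exact mul_sub_exp_div_le_expConj hγ (sub_nonneg.2 (ha i)) _
  · exact mul_sub_exp_div_le_expConj hγ (sub_nonneg.2 (hb j)) _

variable [DecidableEq ι] [DecidableEq κ]

lemma destructionCost_increaseEntry (a : ι → ℝ) (b : κ → ℝ) (C : ι → κ → ℝ) (γ : ℝ)
    (P : ι → κ → ℝ) (i : ι) (j : κ) (t : ℝ) :
    destructionCost a b C γ (increaseEntry P i j t) = destructionCost a b C γ P + C i j * t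
      + (expConj γ (a i - (∑ l, P i l) - t) - expConj γ (a i - ∑ l, P i l))
      + (expConj γ (b j - (∑ k, P k j) - t) - expConj γ (b j - ∑ k, P k j)) := by
  have h : ∑ k, ∑ l, C k l * increaseEntry P i j t k l = (∑ k, ∑ l, C k l * P k l) + C i j * t := by
    simp [increaseEntry, mul_add, Finset.sum_add_distrib, ite_and]
  simp only [destructionCost, h, sum_row_increaseEntry, sum_col_increaseEntry, ← sub_sub]
  rw [sum_comp_sub_ite (expConj γ) (fun k => a k - ∑ l, P k l),
    sum_comp_sub_ite (expConj γ) (fun l => b l - ∑ k, P k l)]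
  ring

lemma increaseEntry_mem_subcouplings {a : ι → ℝ} {b : κ → ℝ} {P : ι → κ → ℝ}
    (hP : P ∈ subcouplings a b) {i : ι} {j : κ} {t : ℝ} (ht : -t ≤ P i j)
    (hr : t ≤ a i - ∑ l, P i l) (hs : t ≤ b j - ∑ k, P k j) :
    increaseEntry P i j t ∈ subcouplings a b := by
  obtain ⟨h0, ha, hb⟩ := hP
  refine ⟨fun k l => ?_, fun k => ?_, fun l => ?_⟩
  · unfold increaseEntry
    split_ifs with h
    · obtain ⟨rfl, rfl⟩ := h
      linarith
    · simpa using h0 k l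
  · rw [sum_row_increaseEntry]
    split_ifs with h
    · subst h
      linarith
    · simpa using ha k
  · rw [sum_col_increaseEntry]
    split_ifs with h
    · subst h
      linarith
    · simpa using hb l

/-- A cost-minimizing subcoupling destroys mass everywhere, and the logarithms of the (scaled)
destroyed masses are dual feasible and complementary to it. -/
lemma optimality_of_isMinOn {a : ι → ℝ} {b : κ → ℝ} {C P : ι → κ → ℝ} {γ : ℝ} (hγ : 0 < γ)
    (ha : ∀ i, 0 < a i) (hb : ∀ j, 0 < b j) (hP : P ∈ subcouplings a b)
    (hmin : IsMinOn (destructionCost a b C γ) (subcouplings a b) P) :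
    (∀ i, 0 < a i - ∑ j, P i j) ∧ (∀ j, 0 < b j - ∑ i, P i j) ∧
    (∀ i j, Real.log (γ * (a i - ∑ j, P i j)) + Real.log (γ * (b j - ∑ i, P i j)) ≤ C i j) ∧
    ∀ i j, (Real.log (γ * (a i - ∑ j, P i j)) + Real.log (γ * (b j - ∑ i, P i j))) * P i j
      = C i j * P i j := by
  have hP0 := hP.1
  have hr : ∀ i, 0 ≤ a i - ∑ j, P i j := fun i => sub_nonneg.2 (hP.2.1 i)
  have hs : ∀ j, 0 ≤ b j - ∑ i, P i j := fun j => sub_nonneg.2 (hP.2.2 j)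
  have key : ∀ i j t, -t ≤ P i j → t ≤ a i - ∑ l, P i l → t ≤ b j - ∑ k, P k j →
      expConj γ (a i - ∑ l, P i l) + expConj γ (b j - ∑ k, P k j) ≤ C i j * t
        + expConj γ (a i - (∑ l, P i l) - t) + expConj γ (b j - (∑ k, P k j) - t) := by
    intro i j t h1 h2 h3
    have h := isMinOn_iff.1 hmin _ (increaseEntry_mem_subcouplings hP h1 h2 h3)
    rw [destructionCost_increaseEntry] at h
    linarith
  have hlower : ∀ i j, 0 < P i j →
      Real.exp (C i j) ≤ (γ * (a i - ∑ l, P i l)) * (γ * (b j - ∑ k, P k j)) := by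
    intro i j hp
    refine exp_le_mul_of_forall_expConj_le hγ (hr i) (hs j) hp fun t h0 hp => ?_
    exact key i j (-t) (by linarith) (by linarith [hr i]) (by linarith [hs j])
  have hrpos : ∀ i, 0 < a i - ∑ j, P i j := by
    intro i
    refine (hr i).lt_of_ne fun h => ?_
    have hsum : 0 < ∑ j, P i j := by linarith [ha i]
    obtain ⟨j, -, hj⟩ := Finset.exists_lt_of_sum_lt (f := fun _ => (0 : ℝ))
      (by simpa using hsum)
    have := hlower i j hj
    rw [← h, mul_zero, zero_mul] at this
    exact (Real.exp_pos _).not_ge this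
  have hspos : ∀ j, 0 < b j - ∑ i, P i j := by
    intro j
    refine (hs j).lt_of_ne fun h => ?_
    have hsum : 0 < ∑ i, P i j := by linarith [hb j]
    obtain ⟨i, -, hi⟩ := Finset.exists_lt_of_sum_lt (f := fun _ => (0 : ℝ))
      (by simpa using hsum)
    have := hlower i j hi
    rw [← h, mul_zero, mul_zero] at this
    exact (Real.exp_pos _).not_ge this
  have hlog : ∀ i j, Real.log (γ * (a i - ∑ j, P i j)) + Real.log (γ * (b j - ∑ i, P i j))
      = Real.log ((γ * (a i - ∑ j, P i j)) * (γ * (b j - ∑ i, P i j))) := fun i j =>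
    (Real.log_mul (mul_pos hγ (hrpos i)).ne' (mul_pos hγ (hspos j)).ne').symm
  have hpos : ∀ i j, 0 < (γ * (a i - ∑ j, P i j)) * (γ * (b j - ∑ i, P i j)) := fun i j =>
    mul_pos (mul_pos hγ (hrpos i)) (mul_pos hγ (hspos j))
  have hfeas : ∀ i j,
      Real.log (γ * (a i - ∑ j, P i j)) + Real.log (γ * (b j - ∑ i, P i j)) ≤ C i j := by
    intro i j
    rw [hlog, Real.log_le_iff_le_exp (hpos i j)]
    refine mul_le_exp_of_forall_expConj_le hγ (hrpos i) (hspos j) fun t h0 h1 h2 => ?_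
    exact key i j t (by linarith [hP0 i j]) h1 h2
  refine ⟨hrpos, hspos, hfeas, fun i j => ?_⟩
  rcases (hP0 i j).eq_or_lt with h | h
  · rw [← h, mul_zero, mul_zero]
  · refine congrArg (· * P i j) ((hfeas i j).antisymm ?_)
    rw [hlog, Real.le_log_iff_exp_le (hpos i j)]
    exact hlower i j h

end Transport

/-- Theorem 1 (exponential instance): strong duality for DROT with the exponential
regularizer, with mass-destruction constraints in the dual; the infimum is attained.
A summand with `a i - (P1) i = 0` is `0 * (Real.log 0 - 1) = 0` since `Real.log 0 = 0`
(matching the stated convention, as the factor `a i - (P1) i` vanishes). -/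
theorem drot_exponential_strong_duality (m n : ℕ) (hm : 0 < m) (hn : 0 < n)
    (a : Fin m → ℝ) (b : Fin n → ℝ) (ha : ∀ i, 0 < a i) (hb : ∀ j, 0 < b j)
    (C : Matrix (Fin m) (Fin n) ℝ) (γ : ℝ) (hγ : 0 < γ) :
    ∃ S : ℝ,
      IsLUB {x : ℝ | ∃ f : Fin m → ℝ, ∃ g : Fin n → ℝ,
        (∀ i j, f i + g j ≤ C i j) ∧
        ((∑ i, f i * a i) + (∑ j, g j * b j)
          - ((∑ i, Real.exp (f i)) + (∑ j, Real.exp (g j))) / γ = x)} S ∧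
      IsLeast {x : ℝ | ∃ P : Matrix (Fin m) (Fin n) ℝ,
        (∀ i j, 0 ≤ P i j) ∧
        (∀ i, (∑ j, P i j) ≤ a i) ∧
        (∀ j, (∑ i, P i j) ≤ b j) ∧
        ((∑ i, ∑ j, C i j * P i j)
          + (∑ i, (a i - ∑ j, P i j) * (Real.log (γ * (a i - ∑ j, P i j)) - 1))
          + (∑ j, (b j - ∑ i, P i j) * (Real.log (γ * (b j - ∑ i, P i j)) - 1))
          = x)} S := by
  have hne : (subcouplings a b).Nonempty :=
    ⟨0, by simp [subcouplings, fun i => (ha i).le, fun j => (hb j).le]⟩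
  obtain ⟨P, hP, hmin⟩ := (isCompact_subcouplings a b).exists_isMinOn hne
    (continuous_destructionCost a b C hγ).continuousOn
  obtain ⟨hr, hs, hfeas, hcompl⟩ := optimality_of_isMinOn hγ ha hb hP hmin
  refine ⟨destructionCost a b C γ P, ⟨?_, ?_⟩, ⟨P, hP.1, hP.2.1, hP.2.2, rfl⟩, ?_⟩
  · rintro _ ⟨f, g, hfg, rfl⟩
    exact dual_value_le_destructionCost hγ hP hfg
  · intro y hy
    refine hy ⟨fun i => Real.log (γ * (a i - ∑ j, P i j)),
      fun j => Real.log (γ * (b j - ∑ i, P i j)), hfeas, ?_⟩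
    refine (dual_value_eq _ _ _ _ γ P).trans ?_
    simp only [destructionCost, hcompl, log_mul_sub_exp_div_eq_expConj hγ (hr _),
      log_mul_sub_exp_div_eq_expConj hγ (hs _)]
  · rintro _ ⟨Q, h0, hQa, hQb, rfl⟩
    exact isMinOn_iff.1 hmin Q ⟨h0, hQa, hQb⟩
end

section
/- (Proposition 1, part 1.) Suppose (f*, g*) ∈ F satisfies ⟨f, a⟩ + ⟨g, b⟩ ≤ ⟨f*, a⟩ + ⟨g*, b⟩ for all (f, g) ∈ F, and set OT = ⟨f*, a⟩ + ⟨g*, b⟩. Suppose (f°, g°) ∈ F satisfies J_{Φ,Ψ}(f, g) ≤ J_{Φ,Ψ}(f°, g°) for all (f, g) ∈ F, and set DROT = J_{Φ,Ψ}(f°, g°). Then Φ(f°) + Ψ(g°) ≤ γ(OT − DROT) ≤ Φ(f*) + Ψ(g*). -/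
/-- Proposition 1, part 1: sandwich bounds on `γ (OT - DROT)` by the regularizer
values at the respective optimal potentials. -/
theorem drot_objective_bounds (m n : ℕ) (hm : 0 < m) (hn : 0 < n)
    (a : Fin m → ℝ) (b : Fin n → ℝ) (C : Matrix (Fin m) (Fin n) ℝ)
    (γ : ℝ) (hγ : 0 < γ)
    (Φ : (Fin m → ℝ) → ℝ) (Ψ : (Fin n → ℝ) → ℝ)
    (fstar : Fin m → ℝ) (gstar : Fin n → ℝ)
    (hstar_feas : ∀ i j, fstar i + gstar j ≤ C i j)
    (hstar_opt : ∀ (f : Fin m → ℝ) (g : Fin n → ℝ), (∀ i j, f i + g j ≤ C i j) →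
      (∑ i, f i * a i) + (∑ j, g j * b j)
        ≤ (∑ i, fstar i * a i) + (∑ j, gstar j * b j))
    (fo : Fin m → ℝ) (go : Fin n → ℝ)
    (ho_feas : ∀ i j, fo i + go j ≤ C i j)
    (ho_opt : ∀ (f : Fin m → ℝ) (g : Fin n → ℝ), (∀ i j, f i + g j ≤ C i j) →
      (∑ i, f i * a i) + (∑ j, g j * b j) - (Φ f + Ψ g) / γ
        ≤ (∑ i, fo i * a i) + (∑ j, go j * b j) - (Φ fo + Ψ go) / γ) :
    Φ fo + Ψ go
      ≤ γ * (((∑ i, fstar i * a i) + (∑ j, gstar j * b j))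
          - ((∑ i, fo i * a i) + (∑ j, go j * b j) - (Φ fo + Ψ go) / γ)) ∧
    γ * (((∑ i, fstar i * a i) + (∑ j, gstar j * b j))
          - ((∑ i, fo i * a i) + (∑ j, go j * b j) - (Φ fo + Ψ go) / γ))
      ≤ Φ fstar + Ψ gstar := by
  have h₁ := hstar_opt fo go ho_feas
  have h₂ := ho_opt fstar gstar hstar_feas
  constructor
  · rw [← div_le_iff₀' hγ]
    linarith
  · rw [← le_div_iff₀' hγ]
    linarith
end

section
/- (Proposition 1, part 2, quadratic instance.) Suppose: (i) (f*, g*) ∈ F satisfies ⟨f, a⟩ + ⟨g, b⟩ ≤ ⟨f*, a⟩ + ⟨g*, b⟩ for all (f, g) ∈ F; (ii) P* ∈ ℝ^{m×n} has nonnegative entries, row sums equal to a, column sums equal to b, and ⟨C, P*⟩ = ⟨f*, a⟩ + ⟨g*, b⟩; (iii) (f°, g°) ∈ F satisfies J(f, g) ≤ J(f°, g°) for all (f, g) ∈ F, with DROT = J(f°, g°); (iv) P° ∈ ℝ^{m×n} has nonnegative entries and satisfies D(P°) = DROT. Then γ⟨C, P* − P°⟩ ≤ ‖f*‖² + ‖g*‖²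 + (γ²/4)(‖a − P°1‖² + ‖b − P°ᵀ1‖²). -/
/-- Proposition 1, part 2 (quadratic instance): upper bound on the transport-cost
gap `γ ⟨C, P* - P°⟩`. -/
theorem drot_quadratic_cost_bound_upper (m n : ℕ) (hm : 0 < m) (hn : 0 < n)
    (a : Fin m → ℝ) (b : Fin n → ℝ) (C : Matrix (Fin m) (Fin n) ℝ)
    (γ : ℝ) (hγ : 0 < γ)
    (fstar : Fin m → ℝ) (gstar : Fin n → ℝ)
    (hstar_feas : ∀ i j, fstar i + gstar j ≤ C i j)
    (hstar_opt : ∀ (f : Fin m → ℝ) (g : Fin n → ℝ), (∀ i j, f i + g j ≤ C i j) →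
      (∑ i, f i * a i) + (∑ j, g j * b j)
        ≤ (∑ i, fstar i * a i) + (∑ j, gstar j * b j))
    (Pstar : Matrix (Fin m) (Fin n) ℝ)
    (hPstar_nonneg : ∀ i j, 0 ≤ Pstar i j)
    (hPstar_row : ∀ i, (∑ j, Pstar i j) = a i)
    (hPstar_col : ∀ j, (∑ i, Pstar i j) = b j)
    (hPstar_cost : (∑ i, ∑ j, C i j * Pstar i j)
      = (∑ i, fstar i * a i) + (∑ j, gstar j * b j))
    (fo : Fin m → ℝ) (go : Fin n → ℝ)
    (ho_feas : ∀ i j, fo i + go j ≤ C i j)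
    (ho_opt : ∀ (f : Fin m → ℝ) (g : Fin n → ℝ), (∀ i j, f i + g j ≤ C i j) →
      (∑ i, f i * a i) + (∑ j, g j * b j)
          - ((∑ i, (f i) ^ 2) + (∑ j, (g j) ^ 2)) / γ
        ≤ (∑ i, fo i * a i) + (∑ j, go j * b j)
          - ((∑ i, (fo i) ^ 2) + (∑ j, (go j) ^ 2)) / γ)
    (Po : Matrix (Fin m) (Fin n) ℝ)
    (hPo_nonneg : ∀ i j, 0 ≤ Po i j)
    (hPo_val : (∑ i, ∑ j, C i j * Po i j)
        + (γ / 4) * ((∑ i, (a i - ∑ j, Po i j) ^ 2)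
          + (∑ j, (b j - ∑ i, Po i j) ^ 2))
      = (∑ i, fo i * a i) + (∑ j, go j * b j)
        - ((∑ i, (fo i) ^ 2) + (∑ j, (go j) ^ 2)) / γ) :
    γ * (∑ i, ∑ j, C i j * (Pstar i j - Po i j))
      ≤ (∑ i, (fstar i) ^ 2) + (∑ j, (gstar j) ^ 2)
        + (γ ^ 2 / 4) * ((∑ i, (a i - ∑ j, Po i j) ^ 2)
          + (∑ j, (b j - ∑ i, Po i j) ^ 2)) := by
  have hopt := ho_opt fstar gstar hstar_feas
  rw [← hPo_val, ← hPstar_cost] at hopt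
  have hsplit : (∑ i, ∑ j, C i j * (Pstar i j - Po i j))
      = (∑ i, ∑ j, C i j * Pstar i j) - ∑ i, ∑ j, C i j * Po i j := by
    simp only [mul_sub, Finset.sum_sub_distrib]
  rw [hsplit]
  have hmul := mul_le_mul_of_nonneg_left hopt hγ.le
  rw [mul_sub, mul_div_cancel₀ _ hγ.ne'] at hmul
  linarith
end

section
/- (Proposition 1, part 3, quadratic instance.) Suppose: (i) (f*, g*) ∈ F satisfies ⟨f, a⟩ + ⟨g, b⟩ ≤ ⟨f*, a⟩ + ⟨g*, b⟩ for all (f, g) ∈ F; (ii) P* ∈ ℝ^{m×n} has nonnegative entries, row sums equal to a, column sums equal to b, and ⟨C, P*⟩ = ⟨f*, a⟩ + ⟨g*, b⟩; (iii) (f°, g°) ∈ F satisfies J(f, g) ≤ J(f°, g°) for all (f, g) ∈ F, with DROT = J(f°, g°); (iv) P° ∈ ℝ^{m×n} has nonnegative entries and satisfies D(P°) = DROT. Then (γ²/4)(‖a − P°1‖² + ‖b − P°ᵀ1‖²) ≤ γ⟨C, P* − P°⟩ − ‖f°‖² − ‖g°‖². -/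
/-- Proposition 1, part 3 (quadratic instance): lower bound on the transport-cost
gap `γ ⟨C, P* - P°⟩` via the marginal penalty. -/
theorem drot_quadratic_cost_bound_lower (m n : ℕ) (hm : 0 < m) (hn : 0 < n)
    (a : Fin m → ℝ) (b : Fin n → ℝ) (C : Matrix (Fin m) (Fin n) ℝ)
    (γ : ℝ) (hγ : 0 < γ)
    (fstar : Fin m → ℝ) (gstar : Fin n → ℝ)
    (hstar_feas : ∀ i j, fstar i + gstar j ≤ C i j)
    (hstar_opt : ∀ (f : Fin m → ℝ) (g : Fin n → ℝ), (∀ i j, f i + g j ≤ C i j) →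
      (∑ i, f i * a i) + (∑ j, g j * b j)
        ≤ (∑ i, fstar i * a i) + (∑ j, gstar j * b j))
    (Pstar : Matrix (Fin m) (Fin n) ℝ)
    (hPstar_nonneg : ∀ i j, 0 ≤ Pstar i j)
    (hPstar_row : ∀ i, (∑ j, Pstar i j) = a i)
    (hPstar_col : ∀ j, (∑ i, Pstar i j) = b j)
    (hPstar_cost : (∑ i, ∑ j, C i j * Pstar i j)
      = (∑ i, fstar i * a i) + (∑ j, gstar j * b j))
    (fo : Fin m → ℝ) (go : Fin n → ℝ)
    (ho_feas : ∀ i j, fo i + go j ≤ C i j)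
    (ho_opt : ∀ (f : Fin m → ℝ) (g : Fin n → ℝ), (∀ i j, f i + g j ≤ C i j) →
      (∑ i, f i * a i) + (∑ j, g j * b j)
          - ((∑ i, (f i) ^ 2) + (∑ j, (g j) ^ 2)) / γ
        ≤ (∑ i, fo i * a i) + (∑ j, go j * b j)
          - ((∑ i, (fo i) ^ 2) + (∑ j, (go j) ^ 2)) / γ)
    (Po : Matrix (Fin m) (Fin n) ℝ)
    (hPo_nonneg : ∀ i j, 0 ≤ Po i j)
    (hPo_val : (∑ i, ∑ j, C i j * Po i j)
        + (γ / 4) * ((∑ i, (a i - ∑ j, Po i j) ^ 2)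
          + (∑ j, (b j - ∑ i, Po i j) ^ 2))
      = (∑ i, fo i * a i) + (∑ j, go j * b j)
        - ((∑ i, (fo i) ^ 2) + (∑ j, (go j) ^ 2)) / γ) :
    (γ ^ 2 / 4) * ((∑ i, (a i - ∑ j, Po i j) ^ 2)
        + (∑ j, (b j - ∑ i, Po i j) ^ 2))
      ≤ γ * (∑ i, ∑ j, C i j * (Pstar i j - Po i j))
        - (∑ i, (fo i) ^ 2) - (∑ j, (go j) ^ 2) := by
  have hgap : (∑ i, ∑ j, C i j * (Pstar i j - Po i j))
      = (∑ i, ∑ j, C i j * Pstar i j) - ∑ i, ∑ j, C i j * Po i j := by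
    simp only [mul_sub, Finset.sum_sub_distrib]
  have hopt := mul_le_mul_of_nonneg_left (hstar_opt fo go ho_feas) hγ.le
  have hval := congrArg (γ * ·) hPo_val
  simp only [mul_sub, mul_div_cancel₀ _ hγ.ne'] at hval
  rw [hgap, hPstar_cost]
  linarith
end

section
/- (Corollary 1, objective-value rate, quadratic instance.) Suppose (f*, g*) ∈ F satisfies ⟨f, a⟩ + ⟨g, b⟩ ≤ ⟨f*, a⟩ + ⟨g*, b⟩ for all (f, g) ∈ F, and set OT = ⟨f*, a⟩ + ⟨g*, b⟩; suppose (f°, g°) ∈ F satisfies J(f, g) ≤ J(f°, g°) for all (f, g) ∈ F, and set DROT = J(f°, g°). Then 0 ≤ OT − DROT ≤ (‖f*‖² + ‖g*‖²)/γ. -/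
/-- Corollary 1 (objective-value rate, quadratic instance):
`0 ≤ OT - DROT ≤ (‖f*‖² + ‖g*‖²) / γ`. -/
theorem drot_quadratic_value_rate (m n : ℕ) (hm : 0 < m) (hn : 0 < n)
    (a : Fin m → ℝ) (b : Fin n → ℝ) (C : Matrix (Fin m) (Fin n) ℝ)
    (γ : ℝ) (hγ : 0 < γ)
    (fstar : Fin m → ℝ) (gstar : Fin n → ℝ)
    (hstar_feas : ∀ i j, fstar i + gstar j ≤ C i j)
    (hstar_opt : ∀ (f : Fin m → ℝ) (g : Fin n → ℝ), (∀ i j, f i + g j ≤ C i j) →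
      (∑ i, f i * a i) + (∑ j, g j * b j)
        ≤ (∑ i, fstar i * a i) + (∑ j, gstar j * b j))
    (fo : Fin m → ℝ) (go : Fin n → ℝ)
    (ho_feas : ∀ i j, fo i + go j ≤ C i j)
    (ho_opt : ∀ (f : Fin m → ℝ) (g : Fin n → ℝ), (∀ i j, f i + g j ≤ C i j) →
      (∑ i, f i * a i) + (∑ j, g j * b j)
          - ((∑ i, (f i) ^ 2) + (∑ j, (g j) ^ 2)) / γ
        ≤ (∑ i, fo i * a i) + (∑ j, go j * b j)
          - ((∑ i, (fo i) ^ 2) + (∑ j, (go j) ^ 2)) / γ) :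
    0 ≤ ((∑ i, fstar i * a i) + (∑ j, gstar j * b j))
        - ((∑ i, fo i * a i) + (∑ j, go j * b j)
          - ((∑ i, (fo i) ^ 2) + (∑ j, (go j) ^ 2)) / γ) ∧
    ((∑ i, fstar i * a i) + (∑ j, gstar j * b j))
        - ((∑ i, fo i * a i) + (∑ j, go j * b j)
          - ((∑ i, (fo i) ^ 2) + (∑ j, (go j) ^ 2)) / γ)
      ≤ ((∑ i, (fstar i) ^ 2) + (∑ j, (gstar j) ^ 2)) / γ := by
  have h_star := ho_opt fstar gstar hstar_feas
  have h_o := hstar_opt fo go ho_feas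
  have h_reg : 0 ≤ ((∑ i, (fo i) ^ 2) + (∑ j, (go j) ^ 2)) / γ := by positivity
  constructor <;> linarith
end

section
/- (Corollary 1, marginal-error rate, quadratic instance.) Suppose (f*, g*) ∈ F satisfies ⟨f, a⟩ + ⟨g, b⟩ ≤ ⟨f*, a⟩ + ⟨g*, b⟩ for all (f, g) ∈ F; suppose (f°, g°) ∈ F satisfies J(f, g) ≤ J(f°, g°) for all (f, g) ∈ F; and suppose P° ∈ ℝ^{m×n} satisfies the stationarity conditions f° = (γ/2)(a − P°1) and g° = (γ/2)(b − P°ᵀ1). Then ‖a − P°1‖² + ‖b − P°ᵀ1‖² ≤ (4/γ²)(‖f*‖² + ‖g*‖²); in particular, ‖a − P°1‖ ≤ (2/γ)√(‖f*‖² + ‖g*‖²) and ‖b − P°ᵀ1‖ ≤ (2/γ)√(‖f*‖² + ‖g*‖²). -/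
/-- Corollary 1 (marginal-error rate, quadratic instance): under the stationarity
conditions `f° = (γ/2)(a - P°1)` and `g° = (γ/2)(b - P°ᵀ1)`, the marginal errors
are `O(1/γ)`. -/
theorem drot_quadratic_marginal_rate (m n : ℕ) (hm : 0 < m) (hn : 0 < n)
    (a : Fin m → ℝ) (b : Fin n → ℝ) (C : Matrix (Fin m) (Fin n) ℝ)
    (γ : ℝ) (hγ : 0 < γ)
    (fstar : Fin m → ℝ) (gstar : Fin n → ℝ)
    (hstar_feas : ∀ i j, fstar i + gstar j ≤ C i j)
    (hstar_opt : ∀ (f : Fin m → ℝ) (g : Fin n → ℝ), (∀ i j, f i + g j ≤ C i j) →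
      (∑ i, f i * a i) + (∑ j, g j * b j)
        ≤ (∑ i, fstar i * a i) + (∑ j, gstar j * b j))
    (fo : Fin m → ℝ) (go : Fin n → ℝ)
    (ho_feas : ∀ i j, fo i + go j ≤ C i j)
    (ho_opt : ∀ (f : Fin m → ℝ) (g : Fin n → ℝ), (∀ i j, f i + g j ≤ C i j) →
      (∑ i, f i * a i) + (∑ j, g j * b j)
          - ((∑ i, (f i) ^ 2) + (∑ j, (g j) ^ 2)) / γ
        ≤ (∑ i, fo i * a i) + (∑ j, go j * b j)
          - ((∑ i, (fo i) ^ 2) + (∑ j, (go j) ^ 2)) / γ)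
    (Po : Matrix (Fin m) (Fin n) ℝ)
    (hstat_f : ∀ i, fo i = (γ / 2) * (a i - ∑ j, Po i j))
    (hstat_g : ∀ j, go j = (γ / 2) * (b j - ∑ i, Po i j)) :
    (∑ i, (a i - ∑ j, Po i j) ^ 2) + (∑ j, (b j - ∑ i, Po i j) ^ 2)
        ≤ (4 / γ ^ 2) * ((∑ i, (fstar i) ^ 2) + (∑ j, (gstar j) ^ 2)) ∧
    Real.sqrt (∑ i, (a i - ∑ j, Po i j) ^ 2)
        ≤ (2 / γ) * Real.sqrt ((∑ i, (fstar i) ^ 2) + (∑ j, (gstar j) ^ 2)) ∧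
    Real.sqrt (∑ j, (b j - ∑ i, Po i j) ^ 2)
        ≤ (2 / γ) * Real.sqrt ((∑ i, (fstar i) ^ 2) + (∑ j, (gstar j) ^ 2)) := by
  have norm_le : (∑ i, (fo i) ^ 2) + (∑ j, (go j) ^ 2)
      ≤ (∑ i, (fstar i) ^ 2) + (∑ j, (gstar j) ^ 2) := by
    rw [← div_le_div_iff_of_pos_right hγ]
    linarith [hstar_opt fo go ho_feas, ho_opt fstar gstar hstar_feas]
  have row_eq : ∑ i, (a i - ∑ j, Po i j) ^ 2 = (4 / γ ^ 2) * ∑ i, (fo i) ^ 2 := by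
    rw [Finset.mul_sum]
    refine Finset.sum_congr rfl fun i _ => ?_
    rw [hstat_f i]
    field_simp
    ring
  have col_eq : ∑ j, (b j - ∑ i, Po i j) ^ 2 = (4 / γ ^ 2) * ∑ j, (go j) ^ 2 := by
    rw [Finset.mul_sum]
    refine Finset.sum_congr rfl fun j _ => ?_
    rw [hstat_g j]
    field_simp
    ring
  have total_le : (∑ i, (a i - ∑ j, Po i j) ^ 2) + (∑ j, (b j - ∑ i, Po i j) ^ 2)
      ≤ (4 / γ ^ 2) * ((∑ i, (fstar i) ^ 2) + (∑ j, (gstar j) ^ 2)) := by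
    rw [row_eq, col_eq, ← mul_add]
    gcongr
  have sqrt_le {x : ℝ}
      (hx : x ≤ (4 / γ ^ 2) * ((∑ i, (fstar i) ^ 2) + (∑ j, (gstar j) ^ 2))) :
      Real.sqrt x
        ≤ (2 / γ) * Real.sqrt ((∑ i, (fstar i) ^ 2) + (∑ j, (gstar j) ^ 2)) := by
    apply Real.sqrt_le_iff.mpr
    refine ⟨by positivity, hx.trans_eq ?_⟩
    rw [mul_pow, Real.sq_sqrt (by positivity), div_pow]
    norm_num
  have row_nonneg : 0 ≤ ∑ i, (a i - ∑ j, Po i j) ^ 2 := by positivity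
  have col_nonneg : 0 ≤ ∑ j, (b j - ∑ i, Po i j) ^ 2 := by positivity
  exact ⟨total_le, sqrt_le (by linarith), sqrt_le (by linarith)⟩
end

section
/- (Key step in the proof of Corollary 2: perturbation plus complementary slackness forces support containment.) Let ε > 0, let (f*, g*) ∈ ℝ^m × ℝ^n, and let P* ∈ ℝ^{m×n} be such that for every pair (i, j) with P*_{ij} = 0 one has f*_i + g*_j − C_{ij} < −ε. Let (f, g) ∈ ℝ^m × ℝ^n satisfy ‖f − f*‖ < ε/3 and ‖g − g*‖ < ε/3, and let P ∈ ℝ^{m×n} have nonnegative entries and satisfy complementary slackness with (f, g): for all i, j, if P_{ij} > 0 then f_i + g_j = C_{ij}. Then for every pair (i, j) with P*_{ij} = 0 one has P_{ij} = 0; that is, supp(P) ⊆ supp(P*). -/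
theorem abs_le_sqrt_sum_sq {ι : Type*} [Fintype ι] (v : ι → ℝ) (i : ι) :
    |v i| ≤ Real.sqrt (∑ k, v k ^ 2) :=
  Real.abs_le_sqrt <|
    Finset.single_le_sum (f := fun k => v k ^ 2) (fun k _ => sq_nonneg (v k)) (Finset.mem_univ i)

/-- Key step in the proof of Corollary 2: if the strictly inactive constraints of
`(f*, g*)` have slack at least `ε`, then any `(f, g)` within `ε/3` of `(f*, g*)`
(in Euclidean norm) and any nonnegative `P` in complementary slackness with
`(f, g)` satisfies `supp(P) ⊆ supp(P*)`. -/
theorem drot_support_containment (m n : ℕ) (C : Matrix (Fin m) (Fin n) ℝ)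
    (ε : ℝ) (hε : 0 < ε)
    (fstar : Fin m → ℝ) (gstar : Fin n → ℝ)
    (Pstar : Matrix (Fin m) (Fin n) ℝ)
    (hslack : ∀ i j, Pstar i j = 0 → fstar i + gstar j - C i j < -ε)
    (f : Fin m → ℝ) (g : Fin n → ℝ)
    (hf : Real.sqrt (∑ i, (f i - fstar i) ^ 2) < ε / 3)
    (hg : Real.sqrt (∑ j, (g j - gstar j) ^ 2) < ε / 3)
    (P : Matrix (Fin m) (Fin n) ℝ)
    (hP_nonneg : ∀ i j, 0 ≤ P i j)
    (hcs : ∀ i j, 0 < P i j → f i + g j = C i j) :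
    ∀ i j, Pstar i j = 0 → P i j = 0 := by
  intro i j hij
  by_contra hne
  have hactive := hcs i j (lt_of_le_of_ne (hP_nonneg i j) (Ne.symm hne))
  have hfi := (abs_lt.mp ((abs_le_sqrt_sum_sq (fun k => f k - fstar k) i).trans_lt hf)).2
  have hgj := (abs_lt.mp ((abs_le_sqrt_sum_sq (fun k => g k - gstar k) j).trans_lt hg)).2
  linarith [hslack i j hij]
end
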